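/- arXiv:2011.02808 — 3 statements merged into one kernel-verified Lean document; each statement's English description precedes it below -/
import Mathlib

section
/- Let m ≥ 1 and let C be a linear binary code of dimension m in F_2^n with n = 2^(m-1), such that every nonzero codeword has Hamming weight at least n/2. Then C is permutation-equivalent to the code D_m: there exists a bijection e : Fin n ≃ (Fin (m-1) → ZMod 2) such that C = { f ∘ e : f an affine function (Fin (m-1) → ZMod 2) → ZMod 2 }. -/
/-- The nontrivial additive character of `ZMod 2` with values in `ℤ`. -/
def signChar (x : ZMod 2) : ℤ := if x = 0 then 1 else -1

lemma signChar_add : ∀ x y : ZMod 2, signChar (x + y) = signChar x * signChar y := by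
  unfold signChar; decide

lemma signChar_mul_self : ∀ x : ZMod 2, signChar x * signChar x = 1 := by
  unfold signChar; decide

lemma zmod_two_eq_of_ne : ∀ x y : ZMod 2, x ≠ y → x + y = 1 := by decide

lemma sum_signChar_eq {n : ℕ} (x : Fin n → ZMod 2) :
    ∑ i, signChar (x i) = n - 2 * hammingNorm x := by
  have h (i : Fin n) : signChar (x i) = 1 - 2 * (if x i ≠ 0 then 1 else 0) := by
    unfold signChar; split_ifs <;> simp_all
  simp only [h, Finset.sum_sub_distrib, ← Finset.mul_sum, Finset.sum_boole, hammingNorm]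
  simp

lemma sum_signChar_linear_nonneg {V : Type*} [AddCommGroup V] [Module (ZMod 2) V] [Fintype V]
    (f : V →ₗ[ZMod 2] ZMod 2) : 0 ≤ ∑ c, signChar (f c) := by
  by_cases h : ∃ c, f c ≠ 0
  · obtain ⟨c₀, hc₀⟩ := h
    have h1 : signChar (f c₀) = -1 := if_neg hc₀
    have h2 : ∑ c, signChar (f (c + c₀)) = ∑ c, signChar (f c) :=
      Equiv.sum_comp (Equiv.addRight c₀) fun c => signChar (f c)
    simp only [map_add, signChar_add, h1, ← Finset.sum_mul] at h2
    linarith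
  · push Not at h
    simp [h, signChar]

section MinimumWeight

variable {n : ℕ} (C : Submodule (ZMod 2) (Fin n → ZMod 2)) [Fintype C]

lemma sum_sq_character_sum :
    ∑ c : C, (∑ i, signChar (c.1 i)) ^ 2 =
      ∑ i, ∑ j, ∑ c : C, signChar (c.1 i + c.1 j) := by
  simp only [sq, Finset.sum_mul_sum, signChar_add]
  rw [Finset.sum_comm]
  exact Finset.sum_congr rfl fun i _ => Finset.sum_comm

lemma correlation_nonneg (i j : Fin n) : 0 ≤ ∑ c : C, signChar (c.1 i + c.1 j) :=
  sum_signChar_linear_nonneg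
    ((LinearMap.proj (R := ZMod 2) (φ := fun _ : Fin n => ZMod 2) i +
      LinearMap.proj (R := ZMod 2) (φ := fun _ : Fin n => ZMod 2) j) ∘ₗ C.subtype)

lemma sum_character_sum_nonneg : 0 ≤ ∑ c : C, ∑ i, signChar (c.1 i) := by
  rw [Finset.sum_comm]
  exact Finset.sum_nonneg fun i _ => sum_signChar_linear_nonneg
    (LinearMap.proj (R := ZMod 2) (φ := fun _ : Fin n => ZMod 2) i ∘ₗ C.subtype)

lemma correlation_eq_card {i j : Fin n} (h : ∀ c ∈ C, c i = c j) :
    ∑ c : C, signChar (c.1 i + c.1 j) = Fintype.card C := by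
  have (c : C) : signChar (c.1 i + c.1 j) = 1 := by
    rw [signChar_add, h c.1 c.2, signChar_mul_self]
  simp [this]

/-- If all character sums at nonzero codewords lie in `[-K, 0]`, their second moment is small. -/
lemma sum_sq_character_sum_le (K : ℤ) (hK : 0 ≤ K)
    (hw : ∀ x ∈ C, x ≠ 0 → n ≤ 2 * hammingNorm x)
    (hu : ∀ x ∈ C, x ≠ 0 → 2 * (hammingNorm x : ℤ) - n ≤ K) :
    ∑ c : C, (∑ i, signChar (c.1 i)) ^ 2 ≤ n ^ 2 + K * n := by
  classical
  have h0 : ∑ i, signChar ((0 : C).1 i) = (n : ℤ) := by simp [signChar]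
  have h1 := sum_character_sum_nonneg C
  rw [← Finset.add_sum_erase _ _ (Finset.mem_univ (0 : C)), h0] at h1 ⊢
  have h2 : ∑ c ∈ Finset.univ.erase (0 : C), (∑ i, signChar (c.1 i)) ^ 2 ≤
      ∑ c ∈ Finset.univ.erase (0 : C), -K * ∑ i, signChar (c.1 i) := by
    refine Finset.sum_le_sum fun c hc => ?_
    have hc0 : c.1 ≠ 0 := fun h => (Finset.ne_of_mem_erase hc) (Subtype.ext h)
    have a := hw c.1 c.2 hc0
    have b := hu c.1 c.2 hc0
    rw [sum_signChar_eq]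
    zify at a
    nlinarith
  rw [← Finset.mul_sum] at h2
  nlinarith

lemma coordinates_separated (hcard : Fintype.card C = 2 * n)
    (hw : ∀ x ∈ C, x ≠ 0 → n ≤ 2 * hammingNorm x) {i j : Fin n}
    (h : ∀ c ∈ C, c i = c j) : i = j := by
  by_contra hij
  have hn : 0 < n := i.pos
  have hle := sum_sq_character_sum_le C n (by positivity) hw fun x _ _ => by
    have : hammingNorm x ≤ n := by simpa using hammingNorm_le_card_fintype (x := x)
    omega
  rw [sum_sq_character_sum] at hle
  have hlt : ∑ _k : Fin n, (2 * n : ℤ) <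
      ∑ k, ∑ l, ∑ c : C, signChar (c.1 k + c.1 l) := by
    have hd (k : Fin n) : ∑ c : C, signChar (c.1 k + c.1 k) = (2 * n : ℤ) := by
      rw [correlation_eq_card C fun _ _ => rfl, hcard]; simp
    refine Finset.sum_lt_sum (fun k _ => ?_) ⟨i, Finset.mem_univ i, ?_⟩
    · rw [← hd k]
      exact Finset.single_le_sum (f := fun l => ∑ c : C, signChar (c.1 k + c.1 l))
        (fun l _ => correlation_nonneg C k l) (Finset.mem_univ k)
    · rw [← hd i]
      refine Finset.single_lt_sum (f := fun l => ∑ c : C, signChar (c.1 i + c.1 l))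
        (Ne.symm hij) (Finset.mem_univ i) (Finset.mem_univ j) ?_
        fun l _ _ => correlation_nonneg C i l
      rw [correlation_eq_card C h, hcard]
      exact_mod_cast (by omega : 0 < 2 * n)
  simp only [Finset.sum_const, Finset.card_univ, Fintype.card_fin, nsmul_eq_mul] at hlt
  nlinarith

lemma one_mem_of_minimum_weight (hn : 0 < n) (hcard : Fintype.card C = 2 * n)
    (hw : ∀ x ∈ C, x ≠ 0 → n ≤ 2 * hammingNorm x) : (1 : Fin n → ZMod 2) ∈ C := by
  by_contra h1
  have hle := sum_sq_character_sum_le C (n - 1) (by omega) hw fun x hx _ => by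
    have hle : hammingNorm x ≤ n := by simpa using hammingNorm_le_card_fintype (x := x)
    have hne : hammingNorm x ≠ n := by
      intro heq
      have hx1 : x = 1 := by
        funext i
        have hall : Finset.univ.filter (fun i => x i ≠ 0) = Finset.univ :=
          Finset.eq_univ_of_card _ (by simpa [hammingNorm] using heq)
        have hmem : i ∈ Finset.univ.filter (fun i => x i ≠ 0) := hall.symm ▸ Finset.mem_univ i
        have hi : x i ≠ 0 := (Finset.mem_filter.1 hmem).2
        simpa using zmod_two_eq_of_ne _ _ hi
      exact h1 (hx1 ▸ hx)
    omega
  rw [sum_sq_character_sum] at hle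
  have hge : ∑ _k : Fin n, (2 * n : ℤ) ≤
      ∑ k, ∑ l, ∑ c : C, signChar (c.1 k + c.1 l) := by
    refine Finset.sum_le_sum fun k _ => ?_
    have hd : ∑ c : C, signChar (c.1 k + c.1 k) = (2 * n : ℤ) := by
      rw [correlation_eq_card C fun _ _ => rfl, hcard]; simp
    rw [← hd]
    exact Finset.single_le_sum (f := fun l => ∑ c : C, signChar (c.1 k + c.1 l))
      (fun l _ => correlation_nonneg C k l) (Finset.mem_univ k)
  simp only [Finset.sum_const, Finset.card_univ, Fintype.card_fin, nsmul_eq_mul] at hge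
  nlinarith

end MinimumWeight


/-- If `m ≥ 1` and `C` is a binary code of dimension `m` and length `n = 2^(m-1)`
whose nonzero codewords all have weight at least `n/2`, then `C` is
permutation-equivalent to the Reed–Muller code `D_m` of evaluation vectors of
affine functions on `F_2^(m-1)`. -/
theorem stmt_1 (m n : ℕ) (hm : 1 ≤ m) (hn : n = 2 ^ (m - 1))
    (C : Submodule (ZMod 2) (Fin n → ZMod 2))
    (hdim : Module.finrank (ZMod 2) C = m)
    (hw : ∀ x ∈ C, x ≠ 0 → n ≤ 2 * hammingNorm x) :
    ∃ e : Fin n ≃ (Fin (m - 1) → ZMod 2),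
      (C : Set (Fin n → ZMod 2)) =
        { y | ∃ (ℓ : (Fin (m - 1) → ZMod 2) →ₗ[ZMod 2] ZMod 2) (c : ZMod 2),
            y = fun i => ℓ (e i) + c } := by
  classical
  have hn0 : 0 < n := hn ▸ by positivity
  have hcard : Fintype.card C = 2 * n := by
    rw [Module.card_eq_pow_finrank (K := ZMod 2), hdim, ZMod.card, hn, ← pow_succ']
    congr 1; omega
  have h1 := one_mem_of_minimum_weight C hn0 hcard hw
  set u : C := ⟨1, h1⟩
  have hu : u ≠ 0 := fun h => by
    simpa [u] using congrFun (congrArg Subtype.val h) ⟨0, hn0⟩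
  obtain ⟨Q, hQ⟩ := (Submodule.span (ZMod 2) {u}).exists_isCompl
  have hQdim : Module.finrank (ZMod 2) Q = m - 1 := by
    have := Submodule.finrank_add_eq_of_isCompl hQ
    rw [finrank_span_singleton hu, hdim] at this
    omega
  let b := Module.finBasisOfFinrankEq (ZMod 2) Q hQdim
  let e₀ : Fin n → Fin (m - 1) → ZMod 2 := fun i k => (b k).1.1 i
  have hspan (x : Fin n → ZMod 2) (hx : x ∈ C) :
      ∃ (ℓ : (Fin (m - 1) → ZMod 2) →ₗ[ZMod 2] ZMod 2) (c : ZMod 2),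
        x = fun i => ℓ (e₀ i) + c := by
    have hmem : (⟨x, hx⟩ : C) ∈ Submodule.span (ZMod 2) {u} ⊔ Q := by simp [hQ.sup_eq_top]
    obtain ⟨y, hy, z, hz, hyz⟩ := Submodule.mem_sup.1 hmem
    obtain ⟨c, rfl⟩ := Submodule.mem_span_singleton.1 hy
    refine ⟨∑ k, b.repr ⟨z, hz⟩ k • LinearMap.proj k, c, funext fun i => ?_⟩
    have hz' : ∑ k, b.repr ⟨z, hz⟩ k * (b k).1.1 i = z.1 i := by
      simpa only [map_sum, map_smul, smul_eq_mul, LinearMap.comp_apply, Submodule.subtype_apply,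
        LinearMap.proj_apply] using congrArg
        (LinearMap.proj (R := ZMod 2) (φ := fun _ : Fin n => ZMod 2) i ∘ₗ C.subtype ∘ₗ Q.subtype)
        (b.sum_repr ⟨z, hz⟩)
    have hx' := congrArg (fun q : C => q.1 i) hyz
    simp [u] at hx'
    simp [e₀, ← hx', ← hz', add_comm]
  have hinj : Function.Injective e₀ := fun i j hij =>
    coordinates_separated C hcard hw fun x hx => by
      obtain ⟨ℓ, c, rfl⟩ := hspan x hx
      simp [hij]
  have hbij : Function.Bijective e₀ :=
    (Fintype.bijective_iff_injective_and_card e₀).2 ⟨hinj, by simp [ZMod.card, hn]⟩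
  refine ⟨Equiv.ofBijective e₀ hbij, Set.ext fun x => ⟨fun hx => hspan x hx, ?_⟩⟩
  rintro ⟨ℓ, c, rfl⟩
  have hform : (fun i => ℓ (Equiv.ofBijective e₀ hbij i) + c) =
      ∑ k, ℓ (fun j => if k = j then 1 else 0) • (b k).1.1 + c • (1 : Fin n → ZMod 2) := by
    funext i
    have := LinearMap.pi_apply_eq_sum_univ ℓ (e₀ i)
    simp [this, e₀, mul_comm]
  rw [hform]
  exact C.add_mem (C.sum_mem fun k _ => C.smul_mem _ (b k).1.2) (C.smul_mem _ h1)
end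

section
/- Let m ≥ 2 and let C be a linear binary code of dimension m in F_2^n with n = 2^(m-1), such that every nonzero codeword has Hamming weight at least n/2. Then every nonzero codeword of C has Hamming weight exactly 2^(m-2) or exactly 2^(m-1). -/
/-- The nontrivial character of `ZMod 2`, with values in `ℤ`. -/
def binarySign (x : ZMod 2) : ℤ := if x = 0 then 1 else -1

theorem binarySign_add (x y : ZMod 2) :
    binarySign (x + y) = binarySign x * binarySign y := by
  decide +revert

/-- A sum of signs of a linear functional over a finite binary space is nonnegative. -/
theorem sum_binarySign_nonneg {V : Type*} [AddCommGroup V] [Fintype V] (f : V →+ ZMod 2) :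
    0 ≤ ∑ v, binarySign (f v) := by
  by_cases h : ∀ v, f v = 0
  · exact Finset.sum_nonneg fun v _ => by simp [h, binarySign]
  · push Not at h
    obtain ⟨w, hw⟩ := h
    have hsum : ∑ v, binarySign (f (v + w)) = ∑ v, binarySign (f v) :=
      Equiv.sum_comp (Equiv.addRight w) fun v => binarySign (f v)
    have hneg : binarySign (f w) = -1 := by simp [binarySign, hw]
    simp only [map_add, binarySign_add, hneg, mul_neg, mul_one, Finset.sum_neg_distrib] at hsum
    linarith

theorem sum_binarySign_eq {n : ℕ} (x : Fin n → ZMod 2) :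
    ∑ i, binarySign (x i) = n - 2 * hammingNorm x := by
  have h : ∀ i, binarySign (x i) = 1 - 2 * (if x i ≠ 0 then 1 else 0) := by
    intro i
    by_cases hi : x i = 0 <;> simp [binarySign, hi]
  simp only [h, Finset.sum_sub_distrib, ← Finset.mul_sum, Finset.sum_boole]
  simp [hammingNorm]

/-- The first moment of the sign sums of a binary code is nonnegative. -/
theorem sum_code_sign_nonneg {n : ℕ} (C : Submodule (ZMod 2) (Fin n → ZMod 2)) [Fintype C] :
    0 ≤ ∑ c : C, ∑ i, binarySign (c.1 i) := by
  rw [Finset.sum_comm]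
  exact Finset.sum_nonneg fun i _ =>
    sum_binarySign_nonneg ((LinearMap.proj i).comp C.subtype).toAddMonoidHom

/-- The second moment of the sign sums of a binary code is at least its diagonal part. -/
theorem le_sum_code_sign_sq {n : ℕ} (C : Submodule (ZMod 2) (Fin n → ZMod 2)) [Fintype C] :
    (n : ℤ) * Fintype.card C ≤ ∑ c : C, (∑ i, binarySign (c.1 i)) ^ 2 := by
  have hpair : ∀ i j, 0 ≤ ∑ c : C, binarySign (c.1 i) * binarySign (c.1 j) := by
    intro i j
    simp only [← binarySign_add]
    exact sum_binarySign_nonneg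
      (((LinearMap.proj i).comp C.subtype).toAddMonoidHom +
        ((LinearMap.proj j).comp C.subtype).toAddMonoidHom)
  have hdiag : ∀ x, binarySign x * binarySign x = 1 := by decide
  calc (n : ℤ) * Fintype.card C
      = ∑ i : Fin n, ∑ c : C, binarySign (c.1 i) * binarySign (c.1 i) := by simp [hdiag]
    _ ≤ ∑ i : Fin n, ∑ j : Fin n, ∑ c : C, binarySign (c.1 i) * binarySign (c.1 j) :=
        Finset.sum_le_sum fun i _ =>
          Finset.single_le_sum (f := fun j => ∑ c : C, binarySign (c.1 i) * binarySign (c.1 j))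
            (fun j _ => hpair i j) (Finset.mem_univ i)
    _ = ∑ c : C, (∑ i, binarySign (c.1 i)) ^ 2 := by
        simp only [sq, Finset.sum_mul_sum]
        conv_rhs => rw [Finset.sum_comm]
        exact Finset.sum_congr rfl fun i _ => Finset.sum_comm

/-- If `m ≥ 2` and `C` is a binary code of dimension `m` and length `n = 2^(m-1)`
whose nonzero codewords all have weight at least `n/2`, then every nonzero
codeword has weight exactly `2^(m-2)` or exactly `2^(m-1)`. -/
theorem stmt_2 (m n : ℕ) (hm : 2 ≤ m) (hn : n = 2 ^ (m - 1))
    (C : Submodule (ZMod 2) (Fin n → ZMod 2))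
    (hdim : Module.finrank (ZMod 2) C = m)
    (hw : ∀ x ∈ C, x ≠ 0 → n ≤ 2 * hammingNorm x) :
    ∀ x ∈ C, x ≠ 0 → hammingNorm x = 2 ^ (m - 2) ∨ hammingNorm x = 2 ^ (m - 1) := by
  classical
  intro x hx hx0
  have : Fintype C := Fintype.ofFinite C
  obtain ⟨k, rfl⟩ : ∃ k, m = k + 2 := ⟨m - 2, by omega⟩
  have hnk : n = 2 * 2 ^ k := by rw [hn, ← pow_succ']; rfl
  have hcard : Fintype.card C = 2 * n := by
    rw [Module.card_eq_pow_finrank (K := ZMod 2), hdim, ZMod.card, hnk]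
    ring
  set a : C → ℤ := fun c => ∑ i, binarySign (c.1 i)
  have hval : ∀ c : C, a c = n - 2 * hammingNorm c.1 := fun c => sum_binarySign_eq c.1
  have hle : ∀ c : C, c ≠ 0 → a c * (n + a c) ≤ 0 := by
    intro c hc
    have h1 : n ≤ 2 * hammingNorm c.1 := hw c c.2 (by simpa using hc)
    have h2 : hammingNorm c.1 ≤ n := by simpa using hammingNorm_le_card_fintype (x := c.1)
    apply mul_nonpos_of_nonpos_of_nonneg <;> rw [hval] <;> omega
  have hzero : a 0 * (n + a 0) = 2 * (n : ℤ) ^ 2 := by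
    simp only [hval, Submodule.coe_zero, hammingNorm_zero]
    push_cast
    ring
  have hsum : 2 * (n : ℤ) ^ 2 ≤ ∑ c, a c * (n + a c) := by
    have h1 : 0 ≤ ∑ c, a c := sum_code_sign_nonneg C
    have h2 : (n : ℤ) * Fintype.card C ≤ ∑ c, a c ^ 2 := le_sum_code_sign_sq C
    have h3 : ∑ c, a c * (n + a c) = n * ∑ c, a c + ∑ c, a c ^ 2 := by
      rw [Finset.mul_sum, ← Finset.sum_add_distrib]
      exact Finset.sum_congr rfl fun c _ => by ring
    rw [hcard] at h2
    push_cast at h2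
    nlinarith [mul_nonneg (Int.natCast_nonneg n) h1]
  rw [← Finset.add_sum_erase _ _ (Finset.mem_univ (0 : C)), hzero] at hsum
  have hnonpos : ∀ c ∈ Finset.univ.erase (0 : C), a c * (n + a c) ≤ 0 :=
    fun c hc => hle c (Finset.ne_of_mem_erase hc)
  have hvanish := (Finset.sum_eq_zero_iff_of_nonpos hnonpos).1
    (le_antisymm (Finset.sum_nonpos hnonpos) (by linarith)) ⟨x, hx⟩
    (by simpa using hx0)
  have hmul : (n - 2 * hammingNorm x : ℤ) * (n + (n - 2 * hammingNorm x)) = 0 := by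
    simpa only [hval] using hvanish
  rw [← hn, Nat.add_sub_cancel]
  rcases mul_eq_zero.1 hmul with h | h <;> omega
end

section
/- Let C ⊆ F_2^16 be a linear binary code of dimension at least 5 all of whose nonzero codewords have Hamming weight 8 or 16. Then C has dimension exactly 5, C is permutation-equivalent to the code D_5 of evaluation vectors of affine functions on F_2^4, and in particular the all-ones word (1,1,...,1) belongs to C. -/
/-- The sign character `a ↦ (-1)^a` of `ZMod 2`, with integer values. -/
def zmodTwoSign (a : ZMod 2) : ℤ := if a = 0 then 1 else -1

lemma zmodTwoSign_add (a b : ZMod 2) :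
    zmodTwoSign (a + b) = zmodTwoSign a * zmodTwoSign b := by
  revert a b; decide

lemma sum_zmodTwoSign {ι : Type*} [Fintype ι] (x : ι → ZMod 2) :
    ∑ i, zmodTwoSign (x i) = Fintype.card ι - 2 * hammingNorm x := by
  have h (i : ι) : zmodTwoSign (x i) = 1 - 2 * if x i ≠ 0 then 1 else 0 := by
    by_cases hi : x i = 0 <;> simp [zmodTwoSign, hi]
  simp only [h, Finset.sum_sub_distrib, ← Finset.mul_sum]
  simp [hammingNorm, Finset.sum_ite]

lemma eq_one_of_hammingNorm_eq_card {ι : Type*} [Fintype ι] {x : ι → ZMod 2}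
    (hx : hammingNorm x = Fintype.card ι) : x = 1 := by
  have h := Finset.card_eq_iff_eq_univ _ |>.1 hx
  funext i
  have hi : x i ≠ 0 := by simpa using h.ge (Finset.mem_univ i)
  exact Fin.eq_one_of_ne_zero _ hi

/-- A sum over a binary code of the signs of `x i + x j` vanishes unless the coordinates `i`
and `j` agree on the code. -/
lemma sum_zmodTwoSign_add_coord {ι : Type*} (C : Submodule (ZMod 2) (ι → ZMod 2)) [Fintype C]
    (i j : ι) [Decidable (∀ x ∈ C, x i = x j)] :
    ∑ x : C, zmodTwoSign (x.1 i + x.1 j) =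
      if ∀ x ∈ C, x i = x j then (Fintype.card C : ℤ) else 0 := by
  split_ifs with h
  · have hx (x : C) : zmodTwoSign (x.1 i + x.1 j) = 1 := by
      rw [h x x.2, CharTwo.add_self_eq_zero]; rfl
    simp [hx]
  · push Not at h
    obtain ⟨y, hy, hij⟩ := h
    have hy' : zmodTwoSign (y i + y j) = -1 :=
      if_neg fun h0 => hij (CharTwo.add_eq_zero.1 h0)
    have key := Equiv.sum_comp (Equiv.addRight (⟨y, hy⟩ : C))
      fun x : C => zmodTwoSign (x.1 i + x.1 j)
    have hx (x : C) : zmodTwoSign ((x.1 i + y i) + (x.1 j + y j)) =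
        -zmodTwoSign (x.1 i + x.1 j) := by
      rw [add_add_add_comm, zmodTwoSign_add, hy', mul_neg_one]
    simp only [Equiv.coe_addRight, Submodule.coe_add, Pi.add_apply, hx,
      Finset.sum_neg_distrib] at key
    lia

open Classical in
/-- The second moment of a binary code counts the pairs of coordinates that agree on it. -/
lemma sum_card_sub_two_mul_hammingNorm_sq {ι : Type*} [Fintype ι]
    (C : Submodule (ZMod 2) (ι → ZMod 2)) [Fintype C] :
    ∑ x : C, ((Fintype.card ι : ℤ) - 2 * hammingNorm x.1) ^ 2 =
      Fintype.card C *
        ((Finset.univ.filter fun p : ι × ι => ∀ x ∈ C, x p.1 = x p.2).card : ℤ) := by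
  simp_rw [← sum_zmodTwoSign, sq, Finset.sum_mul_sum, ← zmodTwoSign_add]
  rw [Finset.sum_comm]
  simp_rw [Finset.sum_comm (s := (Finset.univ : Finset C)), sum_zmodTwoSign_add_coord]
  rw [← Finset.sum_product', ← Finset.sum_filter]
  simp [mul_comm]

open Classical in
/-- A binary code of length `16` and dimension at least `5` with weights `8` and `16` has
`32` words, contains the all-ones word and separates the coordinates. -/
lemma card_eq_and_one_mem_and_separates (C : Submodule (ZMod 2) (Fin 16 → ZMod 2))
    (hdim : 5 ≤ Module.finrank (ZMod 2) C)
    (hw : ∀ x ∈ C, x ≠ 0 → hammingNorm x = 8 ∨ hammingNorm x = 16) :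
    Module.finrank (ZMod 2) C = 5 ∧ 1 ∈ C ∧
      ∀ i j, (∀ x ∈ C, x i = x j) → i = j := by
  have hcard : Fintype.card C = 2 ^ Module.finrank (ZMod 2) C := by
    simpa using Module.card_eq_pow_finrank (K := ZMod 2) (V := C)
  have h32 : 2 ^ 5 ≤ Fintype.card C := hcard ▸ Nat.pow_le_pow_right two_pos hdim
  set P := Finset.univ.filter fun p : Fin 16 × Fin 16 => ∀ x ∈ C, x p.1 = x p.2 with hP
  have hdiag : (Finset.univ : Finset (Fin 16)).diag ⊆ P := by
    intro p hp
    simp_all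
  have hP16 : 16 ≤ P.card := by simpa using Finset.card_le_card hdiag
  have hterm (x : C) : ((Fintype.card (Fin 16) : ℤ) - 2 * hammingNorm x.1) ^ 2 =
      (if x = 0 then 256 else 0) + if x.1 = 1 then 256 else 0 := by
    by_cases h0 : x = 0
    · simp [h0]
    have h0' : x.1 ≠ 0 := by simpa using h0
    rcases hw x x.2 h0' with h | h
    · have h1 : x.1 ≠ 1 := by
        intro h1
        rw [h1] at h
        exact absurd h (by decide)
      simp [h0, h1, h]
    · have h1 : x.1 = 1 := eq_one_of_hammingNorm_eq_card (by simpa using h)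
      rw [h, if_neg h0, if_pos h1]
      norm_num
  have hmoment : ∑ x : C, ((Fintype.card (Fin 16) : ℤ) - 2 * hammingNorm x.1) ^ 2 =
      Fintype.card C * (P.card : ℤ) := by
    convert sum_card_sub_two_mul_hammingNorm_sq C
  simp_rw [hterm] at hmoment
  rw [Finset.sum_add_distrib, Finset.sum_ite_eq' Finset.univ (0 : C),
    if_pos (Finset.mem_univ _)] at hmoment
  have hone : (1 : Fin 16 → ZMod 2) ∈ C := by
    by_contra h
    have hx (x : C) : x.1 ≠ 1 := fun hx => h (hx ▸ x.2)
    simp only [hx, if_false, Finset.sum_const_zero] at hmoment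
    have : 256 = Fintype.card C * P.card := by exact_mod_cast hmoment
    nlinarith
  have hx (x : C) : x.1 = 1 ↔ x = ⟨1, hone⟩ := by rw [Subtype.ext_iff]
  simp_rw [hx] at hmoment
  rw [Finset.sum_ite_eq' Finset.univ, if_pos (Finset.mem_univ _)] at hmoment
  have hprod : 512 = Fintype.card C * P.card := by exact_mod_cast hmoment
  have hC : Fintype.card C = 2 ^ 5 := by nlinarith
  have hPcard : P.card = 16 := by lia
  refine ⟨Nat.pow_right_injective le_rfl (hcard.symm.trans hC), hone, fun i j hij => ?_⟩
  have hPeq := Finset.eq_of_subset_of_card_le hdiag (by simp [hPcard])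
  have hmem : (i, j) ∈ P := by simpa [hP] using hij
  rw [← hPeq] at hmem
  simpa using hmem

/-- A binary code of dimension `m + 1` and length `2 ^ m` that contains the all-ones word and
separates the coordinates is equivalent to the code of affine functions on `F_2^m`. -/
lemma exists_equiv_eq_affine {ι : Type*} [Fintype ι] [Nonempty ι] {m : ℕ}
    (hι : Fintype.card ι = 2 ^ m) (C : Submodule (ZMod 2) (ι → ZMod 2))
    (hdim : Module.finrank (ZMod 2) C = m + 1) (hone : 1 ∈ C)
    (hsep : ∀ i j, (∀ x ∈ C, x i = x j) → i = j) :
    ∃ e : ι ≃ (Fin m → ZMod 2), (C : Set (ι → ZMod 2)) =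
      { y | ∃ (ℓ : (Fin m → ZMod 2) →ₗ[ZMod 2] ZMod 2) (c : ZMod 2),
          y = fun i => ℓ (e i) + c } := by
  obtain ⟨W, hW⟩ := Submodule.exists_isCompl (Submodule.span (ZMod 2) {(⟨1, hone⟩ : C)})
  have hne : (⟨1, hone⟩ : C) ≠ 0 := by
    intro h
    exact one_ne_zero (congrArg Subtype.val h)
  have hWdim : Module.finrank (ZMod 2) W = m := by
    have h := Submodule.finrank_add_eq_of_isCompl hW
    rw [finrank_span_singleton hne, hdim] at h
    lia
  let b := Module.finBasisOfFinrankEq (ZMod 2) W hWdim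
  have hdecomp {x : ι → ZMod 2} (hx : x ∈ C) :
      ∃ (a : Fin m → ZMod 2) (c : ZMod 2), ∀ i, x i = ∑ k, a k * (b k).1.1 i + c := by
    obtain ⟨u, hu, w, hw, huw⟩ := Submodule.mem_sup.1
      (hW.sup_eq_top ▸ Submodule.mem_top : (⟨x, hx⟩ : C) ∈ _ ⊔ W)
    obtain ⟨c, rfl⟩ := Submodule.mem_span_singleton.1 hu
    refine ⟨b.repr ⟨w, hw⟩, c, fun i => ?_⟩
    have hw' := congrArg (fun v : W => v.1.1 i) (b.sum_repr ⟨w, hw⟩)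
    have hx' := congrArg (fun v : C => v.1 i) huw
    simp [-Module.Basis.sum_repr] at hw' hx'
    rw [hw', ← hx', add_comm]
  let f : ι → Fin m → ZMod 2 := fun i k => (b k).1.1 i
  have hf : Function.Injective f := by
    intro i j hij
    refine hsep i j fun x hx => ?_
    obtain ⟨a, c, hac⟩ := hdecomp hx
    have hk (k : Fin m) : (b k).1.1 i = (b k).1.1 j := congrFun hij k
    simp [hac, hk]
  let e := Equiv.ofBijective f
    ((Fintype.bijective_iff_injective_and_card f).2 ⟨hf, by simp [hι]⟩)
  refine ⟨e, Set.ext fun y => ⟨fun hy => ?_, ?_⟩⟩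
  · obtain ⟨a, c, hac⟩ := hdecomp hy
    refine ⟨∑ k, a k • LinearMap.proj k, c, funext fun i => ?_⟩
    simp [hac, e, f]
  · rintro ⟨ℓ, c, rfl⟩
    have hy : (fun i => ℓ (e i) + c) =
        ∑ k, ℓ (fun j => if k = j then 1 else 0) • (b k).1.1 + c • (1 : ι → ZMod 2) := by
      funext i
      rw [LinearMap.pi_apply_eq_sum_univ ℓ (e i)]
      simp [e, f, mul_comm]
    rw [hy]
    exact C.add_mem (C.sum_mem fun k _ => C.smul_mem _ (b k).1.2) (C.smul_mem _ hone)

/-- A binary code `C ⊆ F_2^16` of dimension at least `5` all of whose nonzero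
codewords have Hamming weight `8` or `16` has dimension exactly `5`, is
permutation-equivalent to the code `D_5` of evaluation vectors of affine
functions on `F_2^4`, and contains the all-ones word. -/
theorem stmt_8 (C : Submodule (ZMod 2) (Fin 16 → ZMod 2))
    (hdim : 5 ≤ Module.finrank (ZMod 2) C)
    (hw : ∀ x ∈ C, x ≠ 0 → hammingNorm x = 8 ∨ hammingNorm x = 16) :
    Module.finrank (ZMod 2) C = 5 ∧
    (∃ e : Fin 16 ≃ (Fin 4 → ZMod 2),
      (C : Set (Fin 16 → ZMod 2)) =
        { y | ∃ (ℓ : (Fin 4 → ZMod 2) →ₗ[ZMod 2] ZMod 2) (c : ZMod 2),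
            y = fun i => ℓ (e i) + c }) ∧
    (fun _ : Fin 16 => (1 : ZMod 2)) ∈ C := by
  obtain ⟨h5, hone, hsep⟩ := card_eq_and_one_mem_and_separates C hdim hw
  exact ⟨h5, exists_equiv_eq_affine (by simp) C h5 hone hsep, hone⟩
end
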